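/- Assume the time-varying graph G[A(·)] is cut-balanced and essentially strongly connected (the graph of essential interactions is strongly connected). Then the protocol ẋ(t) = −L[A(t)]x(t) establishes modulus consensus: for every solution the limits x_i⁰ = lim_{t→∞} x_i(t) exist and |x_1⁰| = … = |x_N⁰|. Moreover, if either some pair (i,j) satisfies both ∫_0^∞ a_{ij}⁺ dt = ∞ and ∫_0^∞ a_{ij}⁻ dt = ∞, or the signed graph 𝒢^± of essential interactions is not structurally balanced, then x_i⁰ = 0 for all i and all solutions. -/

import Mathlib

open MeasureTheory Filter Matrix Finset Topology

/-- The signed Laplacian `L[A]` of a signed adjacency matrix: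
off-diagonal entries `L j k = -A j k`, diagonal entries `L j j = ∑ m, |A j m|`. -/
noncomputable def sLap {N : ℕ} (A : Matrix (Fin N) (Fin N) ℝ) : Matrix (Fin N) (Fin N) ℝ :=
  fun j k => if j = k then ∑ m, |A j m| else -A j k

/-- A time-varying signed adjacency matrix: entrywise measurable, locally bounded,
with zero diagonal. -/
def IsAdjacency {N : ℕ} (A : ℝ → Matrix (Fin N) (Fin N) ℝ) : Prop :=
  (∀ j k, Measurable fun t => A t j k) ∧
  (∀ T : ℝ, ∃ C : ℝ, ∀ t ∈ Set.Icc (0:ℝ) T, ∀ j k, |A t j k| ≤ C) ∧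
  (∀ t j, A t j j = 0)

/-- A solution of `ẋ = −L[A(t)]x` on `[0,∞)`: continuous and satisfying the integral
equation (equivalently, locally absolutely continuous and satisfying the ODE a.e.). -/
def IsSolution {N : ℕ} (A : ℝ → Matrix (Fin N) (Fin N) ℝ) (x : ℝ → Fin N → ℝ) : Prop :=
  ContinuousOn x (Set.Ici 0) ∧
  ∀ t ∈ Set.Ici (0:ℝ), ∀ j,
    x t j = x 0 j + ∫ s in (0:ℝ)..t, -((sLap (A s)).mulVec (x s) j)

/-- Quasi-strong connectivity of the static signed graph `G[A]`: some root reaches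
every node along arcs `k → j` present whenever `A j k ≠ 0`. -/
def QSC {N : ℕ} (A : Matrix (Fin N) (Fin N) ℝ) : Prop :=
  ∃ r : Fin N, ∀ j : Fin N, Relation.ReflTransGen (fun k j => A j k ≠ 0) r j

/-- Structural balance of the static signed graph `G[A]`: the nodes split into the camp `S`
and its complement (one possibly empty), with nonnegative weights inside a camp and
nonpositive weights between camps. -/
def StructBal {N : ℕ} (A : Matrix (Fin N) (Fin N) ℝ) : Prop :=
  ∃ S : Set (Fin N), ∀ j k : Fin N,
    ((j ∈ S ↔ k ∈ S) → 0 ≤ A j k) ∧ (¬(j ∈ S ↔ k ∈ S) → A j k ≤ 0)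

/-- `∫_0^∞ |a_{jk}(t)| dt = ∞`: arc `k → j` of the graph of essential interactions. -/
def EssArc {N : ℕ} (A : ℝ → Matrix (Fin N) (Fin N) ℝ) (j k : Fin N) : Prop :=
  ∫⁻ t in Set.Ici (0:ℝ), ENNReal.ofReal |A t j k| = ⊤

/-- `∫_0^∞ a_{jk}⁺(t) dt = ∞`: agents `j` and `k` essentially cooperate. -/
def EssPlus {N : ℕ} (A : ℝ → Matrix (Fin N) (Fin N) ℝ) (j k : Fin N) : Prop :=
  ∫⁻ t in Set.Ici (0:ℝ), ENNReal.ofReal (max (A t j k) 0) = ⊤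

/-- `∫_0^∞ a_{jk}⁻(t) dt = ∞`: agents `j` and `k` essentially compete. -/
def EssMinus {N : ℕ} (A : ℝ → Matrix (Fin N) (Fin N) ℝ) (j k : Fin N) : Prop :=
  ∫⁻ t in Set.Ici (0:ℝ), ENNReal.ofReal (max (-(A t j k)) 0) = ⊤

/-- Reachability from `u` to `v` in the graph of essential interactions. -/
def EssReach {N : ℕ} (A : ℝ → Matrix (Fin N) (Fin N) ℝ) (u v : Fin N) : Prop :=
  Relation.ReflTransGen (fun k j => EssArc A j k) u v

/-- Uniform strong connectivity of the time-varying graph `G[A(·)]`. -/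
def USC {N : ℕ} (A : ℝ → Matrix (Fin N) (Fin N) ℝ) : Prop :=
  ∃ T > (0:ℝ), ∃ ε > (0:ℝ), ∀ t ≥ (0:ℝ), ∀ u v : Fin N,
    Relation.ReflTransGen (fun k j => ε ≤ ∫ s in t..(t + T), |A s j k|) u v

/-- Uniform quasi-strong connectivity of the time-varying graph `G[A(·)]`. -/
def UQSC {N : ℕ} (A : ℝ → Matrix (Fin N) (Fin N) ℝ) : Prop :=
  ∃ T > (0:ℝ), ∃ ε > (0:ℝ), ∀ t ≥ (0:ℝ), ∃ r : Fin N, ∀ j : Fin N,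
    Relation.ReflTransGen (fun k j => ε ≤ ∫ s in t..(t + T), |A s j k|) r j

/-- Cut-balance of the time-varying graph `G[A(·)]` with some constant `K ≥ 1`. -/
def CutBalanced {N : ℕ} (A : ℝ → Matrix (Fin N) (Fin N) ℝ) : Prop :=
  ∃ K : ℝ, 1 ≤ K ∧ ∀ᵐ t ∂(volume.restrict (Set.Ici (0:ℝ))),
    ∀ V : Finset (Fin N), V.Nonempty → V ≠ Finset.univ →
      K⁻¹ * (∑ j ∈ V, ∑ k ∈ Vᶜ, |A t k j|) ≤ (∑ j ∈ V, ∑ k ∈ Vᶜ, |A t j k|) ∧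
      (∑ j ∈ V, ∑ k ∈ Vᶜ, |A t j k|) ≤ K * (∑ j ∈ V, ∑ k ∈ Vᶜ, |A t k j|)

/-- The protocol establishes modulus consensus: the moduli of all opinions converge
to a common limit for every solution. -/
def ModulusConsensus {N : ℕ} (A : ℝ → Matrix (Fin N) (Fin N) ℝ) : Prop :=
  ∀ x : ℝ → Fin N → ℝ, IsSolution A x →
    ∃ c : ℝ, 0 ≤ c ∧ ∀ i, Tendsto (fun t => |x t i|) atTop (𝓝 c)

/-- The protocol establishes bipartite consensus: there are `v ≠ 0` and `ρ ∈ {±1}^N` such that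
every solution converges to `ρ (vᵀ x(0))`. -/
def BipartiteConsensus {N : ℕ} (A : ℝ → Matrix (Fin N) (Fin N) ℝ) : Prop :=
  ∃ v ρ : Fin N → ℝ, v ≠ 0 ∧ (∀ i, ρ i = 1 ∨ ρ i = -1) ∧
    ∀ x : ℝ → Fin N → ℝ, IsSolution A x →
      ∀ i, Tendsto (fun t => x t i) atTop (𝓝 (ρ i * ∑ j, v j * x 0 j))

/-- The essential-interaction signed graph `𝒢^±` is structurally balanced: the camp `S` and
its complement contain all essentially-cooperating pairs inside a camp and all
essentially-competing pairs between the camps. -/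
def EssStructBal {N : ℕ} (A : ℝ → Matrix (Fin N) (Fin N) ℝ) : Prop :=
  ∃ S : Set (Fin N),
    (∀ j k, EssPlus A j k → (j ∈ S ↔ k ∈ S)) ∧
    (∀ j k, EssMinus A j k → ¬(j ∈ S ↔ k ∈ S))

/-- A sequence on `Fin N` is a combination of indicators of initial segments whose
coefficients are nonnegative when the sequence is antitone. -/
lemma exists_sub_eq_sum_indicator {N : ℕ} (y : Fin N → ℝ) (hy : Antitone y) :
    ∃ d : ℕ → ℝ, (∀ l, 0 ≤ d l) ∧ ∀ i j : Fin N, y j - y i =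
      ∑ l ∈ range N, d l * ((if (j : ℕ) ≤ l then 1 else 0) - (if (i : ℕ) ≤ l then 1 else 0)) := by
  rcases Nat.eq_zero_or_pos N with rfl | hN
  · exact ⟨fun _ => 0, fun _ => le_rfl, fun i => i.elim0⟩
  let Y : ℕ → ℝ := fun n => y ⟨min n (N - 1), by omega⟩
  have hYy : ∀ i : Fin N, Y i = y i := fun i => by
    simp only [Y]; congr 1; ext; simp; omega
  have hY : ∀ i : Fin N, y i =
      Y N + ∑ l ∈ range N, (Y l - Y (l + 1)) * (if (i : ℕ) ≤ l then 1 else 0) := by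
    intro i
    have h1 : ∑ l ∈ range N, (Y l - Y (l + 1)) * (if (i : ℕ) ≤ l then (1 : ℝ) else 0)
        = ∑ l ∈ Finset.Ico (i : ℕ) N, (Y l - Y (l + 1)) := by
      rw [← Finset.sum_filter_add_sum_filter_not _ (fun l => (i : ℕ) ≤ l)]
      rw [Finset.sum_eq_zero (s := (range N).filter fun l => ¬ (i : ℕ) ≤ l), add_zero]
      · refine Finset.sum_congr (by ext; simp; tauto) fun l hl => ?_
        simp_all
      · intro l hl
        simp_all
    rw [h1, Finset.sum_Ico_eq_sum_range]
    have h2 := Finset.sum_range_sub' (fun n => Y (i + n)) (N - i)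
    simp only [← add_assoc] at h2
    rw [h2, show (i : ℕ) + (N - i) = N by omega, add_zero, hYy]
    ring
  refine ⟨fun l => Y l - Y (l + 1), fun l => ?_, fun i j => ?_⟩
  · refine sub_nonneg.2 (hy ?_)
    simp only [Fin.mk_le_mk]
    omega
  · rw [hY i, hY j, add_sub_add_left_eq_sub, ← Finset.sum_sub_distrib]
    exact Finset.sum_congr rfl fun l _ => by ring

/-- Dissipation estimate across the cut that separates the first `l + 1` nodes. -/
lemma sum_cut_le_zero {N : ℕ} {K : ℝ} (hK : 1 ≤ K) (b : Fin N → Fin N → ℝ)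
    (hb : ∀ i j, 0 ≤ b i j)
    (hcut : ∀ V : Finset (Fin N), V.Nonempty → V ≠ univ →
      ∑ j ∈ V, ∑ k ∈ Vᶜ, b k j ≤ K * ∑ j ∈ V, ∑ k ∈ Vᶜ, b j k)
    (l : ℕ) (hl : l < N) (φ : Fin N → ℝ) (hφ : ∀ i, φ i = if (i : ℕ) ≤ l then 1 else 0) :
    ∑ i, ∑ j, b i j * ((2 * K)⁻¹ ^ (i : ℕ) * (φ j - φ i) +
      (2 * K)⁻¹ ^ N / (4 * K) * |φ j - φ i|) ≤ 0 := by
  set r := (2 * K)⁻¹ with hr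
  set c := r ^ N / (4 * K) with hc
  have hr0 : 0 < r := by positivity
  have hr1 : r ≤ 1 := inv_le_one_of_one_le₀ (by linarith)
  have hKr : K * r = 1 / 2 := by rw [hr]; field_simp
  have hKc : K * c = r ^ N / 4 := by rw [hc]; field_simp
  have hc0 : 0 < c := by positivity
  have hcl : (K + 1) * c ≤ r ^ l / 2 := by
    have : r ^ N ≤ r ^ l := pow_le_pow_of_le_one hr0.le hr1 hl.le
    nlinarith
  set V : Finset (Fin N) := univ.filter fun i => (i : ℕ) ≤ l with hV
  have hout : ∑ i ∈ V, ∑ j ∈ Vᶜ, b i j = ∑ i, ∑ j, φ i * (1 - φ j) * b i j := by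
    rw [hV, Finset.compl_filter, Finset.sum_filter]
    refine Finset.sum_congr rfl fun i _ => ?_
    rw [Finset.sum_filter]
    split_ifs with h
    · refine Finset.sum_congr rfl fun j _ => ?_
      by_cases h' : (j : ℕ) ≤ l <;> simp [hφ, h, h']
    · simp [hφ, h]
  have hin : ∑ j ∈ V, ∑ i ∈ Vᶜ, b i j = ∑ i, ∑ j, (1 - φ i) * φ j * b i j := by
    rw [Finset.sum_comm, hV, Finset.compl_filter, Finset.sum_filter]
    refine Finset.sum_congr rfl fun i _ => ?_
    rw [Finset.sum_filter]
    split_ifs with h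
    · simp [hφ, h]
    · refine Finset.sum_congr rfl fun j _ => ?_
      by_cases h' : (j : ℕ) ≤ l <;> simp [hφ, h, h']
  have hterm : ∑ i, ∑ j, b i j * (r ^ (i : ℕ) * (φ j - φ i) + c * |φ j - φ i|) ≤
      (r ^ (l + 1) + c) * (∑ j ∈ V, ∑ i ∈ Vᶜ, b i j) -
        (r ^ l - c) * (∑ i ∈ V, ∑ j ∈ Vᶜ, b i j) := by
    rw [hout, hin]
    simp only [Finset.mul_sum, ← Finset.sum_sub_distrib]
    refine Finset.sum_le_sum fun i _ => Finset.sum_le_sum fun j _ => ?_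
    rw [hφ, hφ]
    split_ifs with h1 h2 h2
    · simp
    · have : r ^ (i : ℕ) ≤ r ^ (l + 1) := pow_le_pow_of_le_one hr0.le hr1 (not_le.1 h2)
      simp
      rw [mul_comm]
      exact mul_le_mul_of_nonneg_right (by linarith) (hb i j)
    · have := pow_le_pow_of_le_one hr0.le hr1 h2
      simp
      nlinarith [hb i j]
    · simp
  refine hterm.trans ?_
  have hout0 : 0 ≤ ∑ i ∈ V, ∑ j ∈ Vᶜ, b i j :=
    Finset.sum_nonneg fun i _ => Finset.sum_nonneg fun j _ => hb i j
  by_cases hVu : V = univ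
  · simp [hVu]
  have h := hcut V ⟨⟨l, hl⟩, by simp [hV]⟩ hVu
  have h1 : (r ^ (l + 1) + c) * K ≤ r ^ l - c := by
    rw [pow_succ]
    have : r ^ l * r * K = r ^ l / 2 := by rw [mul_assoc, mul_comm r, hKr]; ring
    nlinarith
  have hp : 0 ≤ r ^ (l + 1) + c := by positivity
  nlinarith [mul_le_mul_of_nonneg_left h hp, mul_le_mul_of_nonneg_right h1 hout0]

/-- Dissipation estimate for a sorted nonnegatively weighted averaging dynamics under
cut-balance. -/
lemma sum_weighted_sub_le_zero {N : ℕ} {K : ℝ} (hK : 1 ≤ K) (b : Fin N → Fin N → ℝ)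
    (hb : ∀ i j, 0 ≤ b i j)
    (hcut : ∀ V : Finset (Fin N), V.Nonempty → V ≠ univ →
      ∑ j ∈ V, ∑ k ∈ Vᶜ, b k j ≤ K * ∑ j ∈ V, ∑ k ∈ Vᶜ, b j k)
    (y : Fin N → ℝ) (hy : Antitone y) :
    ∑ i, ∑ j, b i j * ((2 * K)⁻¹ ^ (i : ℕ) * (y j - y i) +
      (2 * K)⁻¹ ^ N / (4 * K) * |y j - y i|) ≤ 0 := by
  obtain ⟨d, hd, hyd⟩ := exists_sub_eq_sum_indicator y hy
  set c := (2 * K)⁻¹ ^ N / (4 * K) with hc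
  have hc0 : 0 < c := by positivity
  let φ : ℕ → Fin N → ℝ := fun l i => if (i : ℕ) ≤ l then 1 else 0
  calc ∑ i, ∑ j, b i j * ((2 * K)⁻¹ ^ (i : ℕ) * (y j - y i) + c * |y j - y i|)
      ≤ ∑ i, ∑ j, ∑ l ∈ range N, d l * (b i j * ((2 * K)⁻¹ ^ (i : ℕ) * (φ l j - φ l i) +
          c * |φ l j - φ l i|)) := by
        refine Finset.sum_le_sum fun i _ => Finset.sum_le_sum fun j _ => ?_
        have h1 : |y j - y i| ≤ ∑ l ∈ range N, d l * |φ l j - φ l i| := by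
          rw [hyd i j]
          refine (Finset.abs_sum_le_sum_abs _ _).trans (Finset.sum_le_sum fun l _ => ?_)
          rw [abs_mul, abs_of_nonneg (hd l)]
        have h2 : ∑ l ∈ range N, d l * (b i j * ((2 * K)⁻¹ ^ (i : ℕ) * (φ l j - φ l i) +
            c * |φ l j - φ l i|)) = b i j * ((2 * K)⁻¹ ^ (i : ℕ) * (y j - y i) +
            c * ∑ l ∈ range N, d l * |φ l j - φ l i|) := by
          rw [hyd i j, mul_add, Finset.mul_sum, Finset.mul_sum, Finset.mul_sum, Finset.mul_sum,
            ← Finset.sum_add_distrib]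
          exact Finset.sum_congr rfl fun l _ => by simp only [φ]; ring
        rw [h2]
        have := hb i j
        gcongr
    _ = ∑ l ∈ range N, d l * ∑ i, ∑ j, b i j * ((2 * K)⁻¹ ^ (i : ℕ) * (φ l j - φ l i) +
          c * |φ l j - φ l i|) := by
        simp only [Finset.mul_sum]
        rw [Finset.sum_comm (s := range N)]
        exact Finset.sum_congr rfl fun i _ => Finset.sum_comm
    _ ≤ 0 := Finset.sum_nonpos fun l hl => mul_nonpos_of_nonneg_of_nonpos (hd l)
        (sum_cut_le_zero hK b hb hcut l (Finset.mem_range.1 hl) (φ l) fun _ => rfl)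

/-- Signed version of `sum_weighted_sub_le_zero`: the moduli of the opinions are sorted by `σ`,
and `s i` is a sign of `x i`. -/
lemma sum_weighted_sign_le {N : ℕ} {K : ℝ} (hK : 1 ≤ K) (A : Matrix (Fin N) (Fin N) ℝ)
    (hcut : ∀ V : Finset (Fin N), V.Nonempty → V ≠ univ →
      ∑ j ∈ V, ∑ k ∈ Vᶜ, |A k j| ≤ K * ∑ j ∈ V, ∑ k ∈ Vᶜ, |A j k|)
    (x : Fin N → ℝ) (σ : Equiv.Perm (Fin N)) (hσ : Antitone fun i => |x (σ i)|)
    (s : Fin N → ℝ) (hs : ∀ i, |s i| = 1) (hsx : ∀ i, s i * x i = |x i|) :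
    ∑ i : Fin N, (2 * K)⁻¹ ^ (i : ℕ) * (s (σ i) * ∑ j, (A (σ i) j * x j - |A (σ i) j| * x (σ i))) ≤
      -((2 * K)⁻¹ ^ N / (4 * K) * ∑ i, ∑ j, |A i j * x j - |A i j| * x i|) := by
  set c := (2 * K)⁻¹ ^ N / (4 * K) with hc
  have hc0 : 0 < c := by positivity
  have hr1 : (2 * K)⁻¹ ≤ 1 := inv_le_one_of_one_le₀ (by linarith)
  have hr0 : 0 < (2 * K)⁻¹ := by positivity
  have key := sum_weighted_sub_le_zero hK (fun i j => |A (σ i) (σ j)|)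
    (fun _ _ => abs_nonneg _) (fun V (hV : V.Nonempty) (hVu : V ≠ univ) => by
      have h := hcut (V.map σ.toEmbedding) (by simpa using hV) (by
        intro h
        apply hVu
        rw [← Finset.map_univ_equiv σ] at h
        exact Finset.map_injective _ h)
      have hcompl : (V.map σ.toEmbedding)ᶜ = Vᶜ.map σ.toEmbedding := by
        ext i
        simp [Finset.mem_map_equiv]
      simpa only [hcompl, Finset.sum_map, Equiv.coe_toEmbedding] using h)
    (fun i => |x (σ i)|) hσ
  have hD : ∑ i, ∑ j, |A i j * x j - |A i j| * x i| =
      ∑ i, ∑ j, |A (σ i) (σ j) * x (σ j) - |A (σ i) (σ j)| * x (σ i)| := by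
    rw [← Equiv.sum_comp σ]
    exact Finset.sum_congr rfl fun i _ => (Equiv.sum_comp σ _).symm
  have hL : ∀ i, ∑ j, (A (σ i) j * x j - |A (σ i) j| * x (σ i)) =
      ∑ j, (A (σ i) (σ j) * x (σ j) - |A (σ i) (σ j)| * x (σ i)) := fun i =>
    (Equiv.sum_comp σ _).symm
  rw [hD, ← sub_nonpos, sub_neg_eq_add]
  refine le_trans ?_ key
  simp only [hL, Finset.mul_sum, ← Finset.sum_add_distrib]
  refine Finset.sum_le_sum fun i _ => Finset.sum_le_sum fun j _ => ?_
  have hcw : c ≤ (2 * K)⁻¹ ^ (i : ℕ) := by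
    refine (div_le_self (by positivity) (by linarith)).trans ?_
    exact pow_le_pow_of_le_one hr0.le hr1 i.2.le
  set w := (2 * K)⁻¹ ^ (i : ℕ)
  generalize hi : σ i = p
  generalize hj : σ j = q
  have h1 : |A p q * x q - |A p q| * x p| = |s p * (A p q * x q) - (|A p q| * |x p|)| := by
    rw [← hsx, ← one_mul |A p q * x q - |A p q| * x p|, ← hs p, ← abs_mul]
    ring_nf
  have h2 : s p * (A p q * x q) ≤ |A p q| * |x q| := by
    refine (le_abs_self _).trans ?_
    rw [abs_mul, abs_mul, hs, one_mul]
  have h3 : |s p * (A p q * x q) - (|A p q| * |x p|)| ≤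
      (|A p q| * |x q| - s p * (A p q * x q)) + |A p q| * |(|x q| - |x p|)| := by
    have : s p * (A p q * x q) - |A p q| * |x p| =
      -(|A p q| * |x q| - s p * (A p q * x q)) + |A p q| * (|x q| - |x p|) := by ring
    rw [this]
    refine (abs_add_le _ _).trans ?_
    rw [abs_neg, abs_of_nonneg (sub_nonneg.2 h2), abs_mul, abs_abs]
  have h4 : w * (s p * (A p q * x q - |A p q| * x p)) =
      w * (s p * (A p q * x q)) - w * |A p q| * |x p| := by
    rw [← hsx p]; ring
  rw [h1, h4]
  nlinarith [mul_le_mul_of_nonneg_left h3 hc0.le,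
    mul_le_mul_of_nonneg_right hcw (sub_nonneg.2 h2)]

/-- Weighted sum of the moduli of `x`, sorted in decreasing order. -/
noncomputable def sortedSum {N : ℕ} (w x : Fin N → ℝ) : ℝ :=
  ∑ i, w i * |x (Tuple.sort (fun k => -|x k|) i)|

lemma antitone_abs_sort {N : ℕ} (x : Fin N → ℝ) :
    Antitone fun i => |x (Tuple.sort (fun k => -|x k|) i)| := fun _ _ hij =>
  neg_le_neg_iff.1 (Tuple.monotone_sort (fun k => -|x k|) hij)

lemma sum_perm_le_sortedSum {N : ℕ} {w : Fin N → ℝ} (hw : Antitone w) (x : Fin N → ℝ)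
    (σ : Equiv.Perm (Fin N)) : ∑ i, w i * |x (σ i)| ≤ sortedSum w x := by
  set τ := Tuple.sort (fun k => -|x k|) with hτ
  have h : Monovary w fun i => |x (τ i)| := hw.monovary (antitone_abs_sort x)
  simpa [sortedSum] using h.sum_mul_comp_perm_le_sum_mul (σ := σ.trans τ.symm)

lemma sortedSum_sub_le {N : ℕ} {w : Fin N → ℝ} (hw : Antitone w) (hw0 : ∀ i, 0 ≤ w i)
    (x y : Fin N → ℝ) : sortedSum w x - sortedSum w y ≤ (∑ i, w i) * ‖x - y‖ := by
  have h := sum_perm_le_sortedSum hw y (Tuple.sort (fun k => -|x k|))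
  refine (sub_le_sub_left h _).trans ?_
  rw [sortedSum, ← Finset.sum_sub_distrib, Finset.sum_mul]
  refine Finset.sum_le_sum fun i _ => ?_
  rw [← mul_sub]
  refine mul_le_mul_of_nonneg_left ((abs_sub_abs_le_abs_sub _ _).trans ?_) (hw0 i)
  exact norm_le_pi_norm (x - y) _

lemma lipschitzWith_sortedSum {N : ℕ} {w : Fin N → ℝ} (hw : Antitone w) (hw0 : ∀ i, 0 ≤ w i) :
    LipschitzWith (∑ i, w i).toNNReal (sortedSum w) := by
  refine LipschitzWith.of_le_add_mul' _ fun x y => ?_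
  rw [dist_eq_norm]
  linarith [sortedSum_sub_le hw hw0 x y]

lemma LipschitzOnWith.sub_le_integral_of_deriv_le {f g : ℝ → ℝ} {C : NNReal} {a b : ℝ}
    (hab : a ≤ b) (hf : LipschitzOnWith C f (Set.Icc a b)) (hg : IntervalIntegrable g volume a b)
    (h : ∀ᵐ t, t ∈ Set.Ioo a b → DifferentiableAt ℝ f t → deriv f t ≤ g t) :
    f b - f a ≤ ∫ t in a..b, g t := by
  rw [← Set.uIcc_of_le hab] at hf
  have hac := hf.absolutelyContinuousOnInterval
  rw [← hac.integral_deriv_eq_sub]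
  refine intervalIntegral.integral_mono_ae_restrict hab hac.intervalIntegrable_deriv hg ?_
  have hb : ∀ᵐ t, t ≠ b := by simp [ae_iff, measure_singleton]
  have ha : ∀ᵐ t, t ≠ a := by simp [ae_iff, measure_singleton]
  rw [Filter.EventuallyLE, ae_restrict_iff' measurableSet_Icc]
  filter_upwards [h, hac.ae_differentiableAt, ha, hb] with t h1 h2 h3 h4 ht
  exact h1 ⟨lt_of_le_of_ne ht.1 (Ne.symm h3), lt_of_le_of_ne ht.2 h4⟩
    (h2 (by rwa [Set.uIcc_of_le hab]))

lemma neg_sLap_mulVec {N : ℕ} (M : Matrix (Fin N) (Fin N) ℝ) (hM : ∀ j, M j j = 0)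
    (v : Fin N → ℝ) (i : Fin N) :
    -((sLap M).mulVec v i) = ∑ j, (M i j * v j - |M i j| * v i) := by
  rw [Matrix.mulVec, dotProduct, Finset.sum_sub_distrib, ← Finset.sum_mul,
    ← Finset.add_sum_erase _ _ (Finset.mem_univ i),
    ← Finset.add_sum_erase _ (fun j => M i j * v j) (Finset.mem_univ i), hM]
  have : ∑ k ∈ univ.erase i, sLap M i k * v k = -∑ k ∈ univ.erase i, M i k * v k := by
    rw [← Finset.sum_neg_distrib]
    refine Finset.sum_congr rfl fun k hk => ?_
    simp [sLap, (Finset.ne_of_mem_erase hk).symm]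
  rw [this]
  simp [sLap, sub_eq_add_neg]

section Solution

variable {N : ℕ} {A : ℝ → Matrix (Fin N) (Fin N) ℝ} {x : ℝ → Fin N → ℝ}

lemma IsSolution.exists_bound (hA : IsAdjacency A) (hx : IsSolution A x) (T : ℝ) :
    ∃ C : ℝ, 0 ≤ C ∧ ∀ t ∈ Set.Icc (0:ℝ) T, ∀ i j,
      |A t i j * x t j - |A t i j| * x t i| ≤ C := by
  obtain ⟨a, ha⟩ := hA.2.1 T
  obtain ⟨c, hc⟩ := isCompact_Icc.exists_bound_of_continuousOn
    (hx.1.mono (Set.Icc_subset_Ici_self : Set.Icc (0:ℝ) T ⊆ _))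
  have hxc : ∀ t ∈ Set.Icc (0:ℝ) T, ∀ i, |x t i| ≤ |c| := fun t ht i =>
    (norm_le_pi_norm (x t) i).trans ((hc t ht).trans (le_abs_self c))
  refine ⟨|a| * |c| + |a| * |c|, by positivity, fun t ht i j => (abs_sub _ _).trans ?_⟩
  have h := (ha t ht i j).trans (le_abs_self a)
  rw [abs_mul, abs_mul, abs_abs]
  exact add_le_add (mul_le_mul h (hxc t ht j) (abs_nonneg _) (abs_nonneg _))
    (mul_le_mul h (hxc t ht i) (abs_nonneg _) (abs_nonneg _))

lemma IsSolution.aestronglyMeasurable (hA : IsAdjacency A) (hx : IsSolution A x)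
    (i j : Fin N) : AEStronglyMeasurable (fun t => A t i j * x t j - |A t i j| * x t i)
      (volume.restrict (Set.Ici 0)) := by
  have hxm : ∀ i, AEStronglyMeasurable (fun t => x t i) (volume.restrict (Set.Ici 0)) := fun i =>
    ((continuous_apply i).comp_continuousOn hx.1).aestronglyMeasurable measurableSet_Ici
  have hAm := (hA.1 i j).aestronglyMeasurable (μ := volume.restrict (Set.Ici 0))
  exact (hAm.mul (hxm j)).sub (hAm.norm.mul (hxm i))

lemma IsSolution.integrableOn_Ioc (hA : IsAdjacency A) (hx : IsSolution A x) (i j : Fin N)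
    (T : ℝ) : IntegrableOn (fun t => A t i j * x t j - |A t i j| * x t i) (Set.Ioc 0 T) := by
  obtain ⟨C, -, hC⟩ := hx.exists_bound hA T
  refine Integrable.of_bound ?_ C ?_
  · exact (hx.aestronglyMeasurable hA i j).mono_measure
      (Measure.restrict_mono (fun t (ht : t ∈ Set.Ioc 0 T) => ht.1.le) le_rfl)
  · exact (ae_restrict_mem measurableSet_Ioc).mono fun t ht => hC t ⟨ht.1.le, ht.2⟩ i j

lemma IsSolution.intervalIntegrable (hA : IsAdjacency A) (hx : IsSolution A x) (i j : Fin N)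
    {s t : ℝ} (hs : 0 ≤ s) (ht : 0 ≤ t) :
    IntervalIntegrable (fun t => A t i j * x t j - |A t i j| * x t i) volume s t :=
  ((intervalIntegrable_iff_integrableOn_Ioc_of_le hs).2 (hx.integrableOn_Ioc hA i j s)).symm.trans
    ((intervalIntegrable_iff_integrableOn_Ioc_of_le ht).2 (hx.integrableOn_Ioc hA i j t))

lemma IsSolution.eq_add_integral (hA : IsAdjacency A) (hx : IsSolution A x) {t : ℝ}
    (ht : 0 ≤ t) (i : Fin N) :
    x t i = x 0 i + ∫ s in (0:ℝ)..t, ∑ j, (A s i j * x s j - |A s i j| * x s i) := by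
  rw [hx.2 t ht i]
  congr 1
  exact intervalIntegral.integral_congr fun s _ => neg_sLap_mulVec _ (hA.2.2 s) _ _

lemma IsSolution.intervalIntegrable_sum (hA : IsAdjacency A) (hx : IsSolution A x) (i : Fin N)
    {s t : ℝ} (hs : 0 ≤ s) (ht : 0 ≤ t) :
    IntervalIntegrable (fun t => ∑ j, (A t i j * x t j - |A t i j| * x t i)) volume s t := by
  have := IntervalIntegrable.sum univ fun j _ => hx.intervalIntegrable hA i j hs ht
  simpa [Finset.sum_fn] using this

lemma IsSolution.exists_lipschitzOnWith (hA : IsAdjacency A) (hx : IsSolution A x) (T : ℝ) :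
    ∃ C, LipschitzOnWith C x (Set.Icc 0 T) := by
  obtain ⟨C, hC0, hC⟩ := hx.exists_bound hA T
  refine ⟨(N * C).toNNReal, LipschitzOnWith.of_dist_le' fun s hs t ht => ?_⟩
  rw [dist_pi_le_iff (by positivity)]
  intro i
  rw [hx.eq_add_integral hA hs.1, hx.eq_add_integral hA ht.1, dist_add_left, dist_comm,
    dist_eq_norm, intervalIntegral.integral_interval_sub_left
      (hx.intervalIntegrable_sum hA i le_rfl ht.1) (hx.intervalIntegrable_sum hA i le_rfl hs.1),
    dist_comm, Real.dist_eq]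
  refine intervalIntegral.norm_integral_le_of_norm_le_const fun u hu => ?_
  have hu' := Set.uIoc_subset_uIcc hu
  have : u ∈ Set.Icc 0 T := Set.OrdConnected.uIcc_subset (by infer_instance) hs ht hu'
  refine (norm_sum_le _ _).trans ((Finset.sum_le_sum fun j _ => hC u this i j).trans ?_)
  simp

lemma IsSolution.ae_hasDerivAt (hA : IsAdjacency A) (hx : IsSolution A x) {T : ℝ} (hT : 0 ≤ T)
    (i : Fin N) : ∀ᵐ t, t ∈ Set.Ioo 0 T → HasDerivAt (fun t => x t i)
      (∑ j, (A t i j * x t j - |A t i j| * x t i)) t := by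
  filter_upwards [(hx.intervalIntegrable_sum hA i le_rfl hT).ae_hasDerivAt_integral] with t h ht
  rw [Set.uIcc_of_le hT] at h
  refine ((h (Set.Ioo_subset_Icc_self ht) 0 ⟨le_rfl, hT⟩).const_add (x 0 i)).congr_of_eventuallyEq ?_
  filter_upwards [Ioi_mem_nhds ht.1] with s hs
  exact hx.eq_add_integral hA (le_of_lt hs) i

/-- Total variation of the opinions along a solution is controlled under cut-balance. -/
lemma IsSolution.exists_integral_le (hA : IsAdjacency A) (hCB : CutBalanced A)
    (hx : IsSolution A x) : ∃ I : ℝ, ∀ T : ℝ, 0 ≤ T →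
      ∫ t in (0:ℝ)..T, ∑ i, ∑ j, |A t i j * x t j - |A t i j| * x t i| ≤ I := by
  obtain ⟨K, hK, hcut⟩ := hCB
  have hr1 : (2 * K)⁻¹ ≤ 1 := inv_le_one_of_one_le₀ (by linarith)
  have hr0 : 0 < (2 * K)⁻¹ := by positivity
  set w : Fin N → ℝ := fun i => (2 * K)⁻¹ ^ (i : ℕ) with hw
  have hwa : Antitone w := fun i j hij => pow_le_pow_of_le_one hr0.le hr1 hij
  have hw0 : ∀ i, 0 ≤ w i := fun i => by positivity
  set c := (2 * K)⁻¹ ^ N / (4 * K) with hc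
  have hc0 : 0 < c := by positivity
  refine ⟨sortedSum w (x 0) / c, fun T hT => ?_⟩
  rw [le_div_iff₀' hc0]
  obtain ⟨C, hC⟩ := hx.exists_lipschitzOnWith hA T
  have hD : IntervalIntegrable
      (fun t => ∑ i, ∑ j, |A t i j * x t j - |A t i j| * x t i|) volume 0 T := by
    have := IntervalIntegrable.sum univ fun i _ => IntervalIntegrable.sum univ fun j _ =>
      (hx.intervalIntegrable hA i j le_rfl hT).abs
    simpa [Finset.sum_fn] using this
  have hS0 : 0 ≤ sortedSum w (x T) :=
    Finset.sum_nonneg fun i _ => mul_nonneg (hw0 i) (abs_nonneg _)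
  have main := ((lipschitzWith_sortedSum hwa hw0).comp_lipschitzOnWith
    hC).sub_le_integral_of_deriv_le hT (hD.const_mul (-c)) ?_
  · rw [intervalIntegral.integral_const_mul] at main
    simp only [Function.comp] at main
    linarith
  rw [ae_restrict_iff' measurableSet_Ici] at hcut
  have hder := (ae_all_iff.2 fun i => hx.ae_hasDerivAt hA hT i)
  filter_upwards [hcut, hder] with t hcut hder ht hdiff
  set σ := Tuple.sort (fun k => -|x t k|) with hσ
  let s : Fin N → ℝ := fun i => if 0 ≤ x t i then 1 else -1
  have hs : ∀ i, |s i| = 1 := fun i => by simp only [s]; split_ifs <;> simp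
  have hsx : ∀ i, s i * x t i = |x t i| := fun i => by
    simp only [s]
    split_ifs with h
    · rw [one_mul, abs_of_nonneg h]
    · rw [neg_one_mul, abs_of_neg (not_le.1 h)]
  have hg : HasDerivAt (fun u => ∑ i, w i * (s (σ i) * x u (σ i)))
      (∑ i, w i * (s (σ i) * ∑ j, (A t (σ i) j * x t j - |A t (σ i) j| * x t (σ i)))) t :=
    HasDerivAt.fun_sum fun i _ => ((hder (σ i) ht).const_mul _).const_mul _
  have hmin : IsLocalMin (fun u => sortedSum w (x u) - ∑ i, w i * (s (σ i) * x u (σ i))) t := by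
    refine Filter.Eventually.of_forall fun u => ?_
    have h1 : sortedSum w (x t) = ∑ i, w i * (s (σ i) * x t (σ i)) := by
      simp only [hsx]; rfl
    have h2 : ∑ i, w i * (s (σ i) * x u (σ i)) ≤ sortedSum w (x u) := by
      refine le_trans (Finset.sum_le_sum fun i _ => ?_) (sum_perm_le_sortedSum hwa (x u) σ)
      refine mul_le_mul_of_nonneg_left ((le_abs_self _).trans ?_) (hw0 i)
      rw [abs_mul, hs, one_mul]
    simp only
    linarith
  have heq := hmin.hasDerivAt_eq_zero (hdiff.hasDerivAt.sub hg)
  rw [sub_eq_zero.1 heq, neg_mul]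
  refine sum_weighted_sign_le hK (A t) (fun V hV hVu => ?_) (x t) σ (antitone_abs_sort _) s hs hsx
  have := (hcut ht.1.le V hV hVu).1
  rwa [inv_mul_le_iff₀ (by linarith)] at this

lemma IsSolution.integrableOn_Ioi (hA : IsAdjacency A) (hCB : CutBalanced A)
    (hx : IsSolution A x) (i j : Fin N) :
    IntegrableOn (fun t => A t i j * x t j - |A t i j| * x t i) (Set.Ioi 0) := by
  obtain ⟨I, hI⟩ := hx.exists_integral_le hA hCB
  refine integrableOn_Ioi_of_intervalIntegral_norm_bounded I 0
    (fun T => hx.integrableOn_Ioc hA i j T) tendsto_id ?_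
  filter_upwards [eventually_ge_atTop 0] with T hT
  refine le_trans (intervalIntegral.integral_mono_on hT
    (hx.intervalIntegrable hA i j le_rfl hT).norm ?_ fun t _ => ?_) (hI T hT)
  · have := IntervalIntegrable.sum univ fun i _ => IntervalIntegrable.sum univ fun j _ =>
      (hx.intervalIntegrable hA i j le_rfl hT).abs
    simpa [Finset.sum_fn] using this
  · refine le_trans ?_ (Finset.single_le_sum
      (f := fun i => ∑ j, |A t i j * x t j - |A t i j| * x t i|)
      (fun i _ => Finset.sum_nonneg fun j _ => abs_nonneg _) (Finset.mem_univ i))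
    exact Finset.single_le_sum (f := fun j => |A t i j * x t j - |A t i j| * x t i|)
      (fun j _ => abs_nonneg _) (Finset.mem_univ j)

lemma IsSolution.exists_tendsto (hA : IsAdjacency A) (hCB : CutBalanced A)
    (hx : IsSolution A x) (i : Fin N) : ∃ c, Tendsto (fun t => x t i) atTop (𝓝 c) := by
  have hF : IntegrableOn (fun t => ∑ j, (A t i j * x t j - |A t i j| * x t i)) (Set.Ioi 0) :=
    integrable_finsetSum _ fun j _ => hx.integrableOn_Ioi hA hCB i j
  refine ⟨_, ((intervalIntegral_tendsto_integral_Ioi 0 hF tendsto_id).const_add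
    (x 0 i)).congr' ?_⟩
  filter_upwards [eventually_ge_atTop 0] with t ht
  exact (hx.eq_add_integral hA ht i).symm

end Solution

/-- A locally bounded function whose tail is dominated by a multiple of an integrable function
has finite integral. -/
lemma lintegral_ofReal_ne_top_of_eventually_le {f g : ℝ → ℝ} {δ : ℝ}
    (hf : ∀ T : ℝ, ∃ C : ℝ, ∀ t ∈ Set.Icc (0:ℝ) T, f t ≤ C) (hg : IntegrableOn g (Set.Ioi 0))
    (hδ : 0 < δ) (h : ∀ᶠ t in atTop, δ * f t ≤ |g t|) :
    ∫⁻ t in Set.Ici (0:ℝ), ENNReal.ofReal (f t) ≠ ⊤ := by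
  obtain ⟨T, hT⟩ := eventually_atTop.1 (h.and (eventually_gt_atTop 0))
  obtain ⟨C, hC⟩ := hf T
  have hT0 : 0 < T := (hT T le_rfl).2
  have hsub : Set.Ici (0:ℝ) ⊆ Set.Icc 0 T ∪ Set.Ioi T := fun t ht => by
    by_cases h : t ≤ T
    · exact Or.inl ⟨ht, h⟩
    · exact Or.inr (not_le.1 h)
  refine ne_top_of_le_ne_top ?_ ((lintegral_mono_set hsub).trans (lintegral_union_le _ _ _))
  refine ENNReal.add_ne_top.2 ⟨?_, ?_⟩
  · refine ne_top_of_le_ne_top ?_ (setLIntegral_mono (g := fun _ => ENNReal.ofReal C)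
      measurable_const fun t ht => ENNReal.ofReal_le_ofReal (hC t ht))
    simp [ENNReal.mul_eq_top]
  · have hg' : IntegrableOn (fun t => δ⁻¹ * |g t|) (Set.Ioi T) :=
      ((hg.mono_set (Set.Ioi_subset_Ioi hT0.le)).abs).const_mul _
    refine ne_top_of_le_ne_top hg'.lintegral_lt_top.ne
      (setLIntegral_mono' measurableSet_Ioi fun t ht => ENNReal.ofReal_le_ofReal ?_)
    rw [le_inv_mul_iff₀ hδ]
    exact (hT t (le_of_lt ht)).1

section Limits

variable {N : ℕ} {A : ℝ → Matrix (Fin N) (Fin N) ℝ} {x : ℝ → Fin N → ℝ} {x0 : Fin N → ℝ}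

lemma EssPlus.limit_eq {i j : Fin N} (h : EssPlus A i j) (hA : IsAdjacency A)
    (hCB : CutBalanced A) (hx : IsSolution A x)
    (hlim : ∀ i, Tendsto (fun t => x t i) atTop (𝓝 (x0 i))) : x0 i = x0 j := by
  by_contra hne
  have hpos : 0 < |x0 j - x0 i| := abs_pos.2 (sub_ne_zero.2 (Ne.symm hne))
  refine lintegral_ofReal_ne_top_of_eventually_le (δ := |x0 j - x0 i| / 2) (fun T => ?_)
    (hx.integrableOn_Ioi hA hCB i j) (by positivity) ?_ h
  · obtain ⟨C, hC⟩ := hA.2.1 T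
    exact ⟨C, fun t ht => (max_le (le_abs_self _) (abs_nonneg _)).trans (hC t ht i j)⟩
  · filter_upwards [((hlim j).sub (hlim i)).abs.eventually (lt_mem_nhds (half_lt_self hpos))]
      with t ht
    rcases le_total 0 (A t i j) with ha | ha
    · rw [max_eq_left ha, abs_of_nonneg ha, ← mul_sub, abs_mul, abs_of_nonneg ha, mul_comm]
      exact mul_le_mul_of_nonneg_left ht.le ha
    · rw [max_eq_right ha, mul_zero]
      exact abs_nonneg _

lemma EssMinus.limit_eq_neg {i j : Fin N} (h : EssMinus A i j) (hA : IsAdjacency A)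
    (hCB : CutBalanced A) (hx : IsSolution A x)
    (hlim : ∀ i, Tendsto (fun t => x t i) atTop (𝓝 (x0 i))) : x0 i = -x0 j := by
  by_contra hne
  have hpos : 0 < |x0 j + x0 i| := abs_pos.2 fun h => hne (by linarith)
  refine lintegral_ofReal_ne_top_of_eventually_le (δ := |x0 j + x0 i| / 2) (fun T => ?_)
    (hx.integrableOn_Ioi hA hCB i j) (by positivity) ?_ h
  · obtain ⟨C, hC⟩ := hA.2.1 T
    exact ⟨C, fun t ht => (max_le (neg_le_abs _) (abs_nonneg _)).trans (hC t ht i j)⟩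
  · filter_upwards [((hlim j).add (hlim i)).abs.eventually (lt_mem_nhds (half_lt_self hpos))]
      with t ht
    rcases le_total 0 (A t i j) with ha | ha
    · rw [max_eq_right (neg_nonpos.2 ha), mul_zero]
      exact abs_nonneg _
    · have : A t i j * x t j - |A t i j| * x t i = A t i j * (x t j + x t i) := by
        rw [abs_of_nonpos ha]; ring
      rw [max_eq_left (neg_nonneg.2 ha), this, abs_mul, abs_of_nonpos ha, mul_comm]
      exact mul_le_mul_of_nonneg_left ht.le (neg_nonneg.2 ha)

lemma EssArc.essPlus_or_essMinus {i j : Fin N} (h : EssArc A i j) (hA : IsAdjacency A) :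
    EssPlus A i j ∨ EssMinus A i j := by
  rw [EssPlus, EssMinus, ← ENNReal.add_eq_top,
    ← lintegral_add_left ((hA.1 i j).max measurable_const).ennreal_ofReal, ← h]
  refine lintegral_congr fun t => ?_
  rw [← ENNReal.ofReal_add (le_max_right _ _) (le_max_right _ _)]
  congr 1
  rcases le_total 0 (A t i j) with ha | ha
  · rw [max_eq_left ha, max_eq_right (neg_nonpos.2 ha), abs_of_nonneg ha, add_zero]
  · rw [max_eq_right ha, max_eq_left (neg_nonneg.2 ha), abs_of_nonpos ha, zero_add]

lemma EssReach.abs_limit_eq {u v : Fin N} (h : EssReach A u v) (hA : IsAdjacency A)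
    (hCB : CutBalanced A) (hx : IsSolution A x)
    (hlim : ∀ i, Tendsto (fun t => x t i) atTop (𝓝 (x0 i))) : |x0 u| = |x0 v| := by
  induction h with
  | refl => rfl
  | tail _ h ih =>
    rw [ih]
    rcases h.essPlus_or_essMinus hA with h | h
    · rw [h.limit_eq hA hCB hx hlim]
    · rw [h.limit_eq_neg hA hCB hx hlim, abs_neg]

end Limits

/-- cut-balance plus essential strong connectivity imply modulus consensus
(opinions converge with equal moduli); moreover if some pair both essentially cooperates and
competes, or the essential signed graph is structurally unbalanced, all opinions tend to 0. -/
theorem stmt16 {N : ℕ} (hN : 2 ≤ N) (A : ℝ → Matrix (Fin N) (Fin N) ℝ)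
    (hA : IsAdjacency A) (hCB : CutBalanced A)
    (hESC : ∀ u v : Fin N, EssReach A u v) :
    (∀ x : ℝ → Fin N → ℝ, IsSolution A x →
      ∃ x0 : Fin N → ℝ, (∀ i, Tendsto (fun t => x t i) atTop (𝓝 (x0 i))) ∧
        ∀ i j : Fin N, |x0 i| = |x0 j|) ∧
    (((∃ i j : Fin N, EssPlus A i j ∧ EssMinus A i j) ∨ ¬ EssStructBal A) →
      ∀ x : ℝ → Fin N → ℝ, IsSolution A x →
        ∀ i, Tendsto (fun t => x t i) atTop (𝓝 0)) := by
  have hmod : ∀ x : ℝ → Fin N → ℝ, IsSolution A x →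
      ∃ x0 : Fin N → ℝ, (∀ i, Tendsto (fun t => x t i) atTop (𝓝 (x0 i))) ∧
        ∀ i j : Fin N, |x0 i| = |x0 j| := by
    intro x hx
    choose x0 hlim using hx.exists_tendsto hA hCB
    exact ⟨x0, hlim, fun i j => (hESC i j).abs_limit_eq hA hCB hx hlim⟩
  refine ⟨hmod, fun hunb x hx i => ?_⟩
  obtain ⟨x0, hlim, heq⟩ := hmod x hx
  suffices ∃ k, x0 k = 0 by
    obtain ⟨k, hk⟩ := this
    have : x0 i = 0 := abs_eq_zero.1 (by rw [heq i k, hk, abs_zero])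
    exact this ▸ hlim i
  rcases hunb with ⟨k, l, hp, hm⟩ | hunb
  · have h1 := hp.limit_eq hA hCB hx hlim
    have h2 := hm.limit_eq_neg hA hCB hx hlim
    exact ⟨k, by linarith⟩
  · by_contra! hne
    refine hunb ⟨{k | 0 < x0 k}, fun j k h => ?_, fun j k h => ?_⟩
    · simp only [Set.mem_ofPred_eq, h.limit_eq hA hCB hx hlim]
    · have h2 := h.limit_eq_neg hA hCB hx hlim
      simp only [Set.mem_ofPred_eq, h2]
      rcases lt_or_gt_of_ne (hne k) with h | h
      · simp [h, h.le]
      · simp [h, h.le]
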